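/- arXiv:2206.14693 — 3 statements merged into one kernel-verified Lean document; each statement's English description precedes it below -/
import Mathlib

section
/- Let S be a semigroup and let R be an S-graded ring. Then R is epsilon-strongly S-graded if and only if for all s ∈ S and t ∈ V(s) there exist elements ε_{s,t} ∈ R_s R_t and ε'_{t,s} ∈ R_t R_s such that ε_{s,t} r = r = r ε'_{t,s} for every r ∈ R_s. -/
open scoped Pointwise

/-- The set `E(S)` of idempotent elements of a semigroup `S`. -/
def idempotentSet (S : Type*) [Semigroup S] : Set S := {s | s * s = s}

/-- The set `V(s) = {t ∈ S ∣ sts = s and tst = t}`. -/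
def invSet {S : Type*} [Semigroup S] (s : S) : Set S :=
  {t | s * t * s = s ∧ t * s * t = t}

/-- The product `A B` of two additive subgroups of a ring: the additive subgroup
generated by all products `a * b` with `a ∈ A`, `b ∈ B`. -/
def subgroupMul {R : Type*} [NonUnitalRing R] (A B : AddSubgroup R) : AddSubgroup R :=
  AddSubgroup.closure ((A : Set R) * (B : Set R))

/-- `R` is an `S`-graded ring via the family `𝒜` of additive subgroups:
`R = ⊕_{s ∈ S} R_s` (internal direct sum) and `R_s R_t ⊆ R_{st}`. -/
structure IsSemigroupGrading {S R : Type*} [Semigroup S] [DecidableEq S] [NonUnitalRing R]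
    (𝒜 : S → AddSubgroup R) : Prop where
  internal : DirectSum.IsInternal 𝒜
  mul_mem : ∀ s t : S, ∀ a ∈ 𝒜 s, ∀ b ∈ 𝒜 t, a * b ∈ 𝒜 (s * t)

/-- `R` is symmetrically `S`-graded: `R_s = R_s R_t R_s` for all `s ∈ S`, `t ∈ V(s)`. -/
def SymmetricallyGraded {S R : Type*} [Semigroup S] [NonUnitalRing R]
    (𝒜 : S → AddSubgroup R) : Prop :=
  ∀ s : S, ∀ t ∈ invSet s, 𝒜 s = subgroupMul (subgroupMul (𝒜 s) (𝒜 t)) (𝒜 s)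

/-- A subset `P` of `R` (closed under multiplication) is a unital ring:
it has a two-sided multiplicative identity element. -/
def HasUnity {R : Type*} [NonUnitalRing R] (P : AddSubgroup R) : Prop :=
  ∃ u ∈ P, ∀ x ∈ P, u * x = x ∧ x * u = x

/-- A subset `P` of `R` is an s-unital ring: `x ∈ Px` and `x ∈ xP` for every `x ∈ P`. -/
def IsSUnital {R : Type*} [NonUnitalRing R] (P : AddSubgroup R) : Prop :=
  ∀ x ∈ P, (∃ u ∈ P, u * x = x) ∧ (∃ v ∈ P, x * v = x)

/-- A subset `P` of `R` is a von Neumann regular ring: `r ∈ rPr` for every `r ∈ P`. -/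
def IsVonNeumannRegular {R : Type*} [NonUnitalRing R] (P : AddSubgroup R) : Prop :=
  ∀ r ∈ P, ∃ x ∈ P, r = r * x * r

/-- `R` is epsilon-strongly `S`-graded. -/
def EpsilonStronglyGraded {S R : Type*} [Semigroup S] [NonUnitalRing R]
    (𝒜 : S → AddSubgroup R) : Prop :=
  SymmetricallyGraded 𝒜 ∧ ∀ s : S, ∀ t ∈ invSet s, HasUnity (subgroupMul (𝒜 s) (𝒜 t))

/-- `R` is nearly epsilon-strongly `S`-graded. -/
def NearlyEpsilonStronglyGraded {S R : Type*} [Semigroup S] [NonUnitalRing R]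
    (𝒜 : S → AddSubgroup R) : Prop :=
  SymmetricallyGraded 𝒜 ∧ ∀ s : S, ∀ t ∈ invSet s, IsSUnital (subgroupMul (𝒜 s) (𝒜 t))

/-- `R` is strongly `S`-graded: `R_s R_t = R_{st}` for all `s, t ∈ S`. -/
def StronglyGraded {S R : Type*} [Semigroup S] [NonUnitalRing R]
    (𝒜 : S → AddSubgroup R) : Prop :=
  ∀ s t : S, subgroupMul (𝒜 s) (𝒜 t) = 𝒜 (s * t)

/-- `R` is graded von Neumann regular: for all `s ∈ S`, `r ∈ R_s` and `t ∈ V(s)`,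
there is `y ∈ R_t` with `r = ryr`. -/
def GradedVonNeumannRegular {S R : Type*} [Semigroup S] [NonUnitalRing R]
    (𝒜 : S → AddSubgroup R) : Prop :=
  ∀ s : S, ∀ r ∈ 𝒜 s, ∀ t ∈ invSet s, ∃ y ∈ 𝒜 t, r = r * y * r

section SubgroupMul

variable {R : Type*} [NonUnitalRing R]

theorem mul_mem_subgroupMul {A B : AddSubgroup R} {a b : R} (ha : a ∈ A) (hb : b ∈ B) :
    a * b ∈ subgroupMul A B :=
  AddSubgroup.subset_closure (Set.mul_mem_mul ha hb)

/-- To show that `A B` is contained in an additive subgroup, it suffices to consider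
the products `a * b`. -/
theorem subgroupMul_le {A B C : AddSubgroup R} (h : ∀ a ∈ A, ∀ b ∈ B, a * b ∈ C) :
    subgroupMul A B ≤ C :=
  (AddSubgroup.closure_le C).2 (Set.mul_subset_iff.2 h)

theorem subgroupMul_assoc (A B C : AddSubgroup R) :
    subgroupMul (subgroupMul A B) C = subgroupMul A (subgroupMul B C) := by
  apply le_antisymm
  · refine subgroupMul_le fun x hx c hc ↦ ?_
    have h : subgroupMul A B ≤
        (subgroupMul A (subgroupMul B C)).comap (AddMonoidHom.mulRight c) :=
      subgroupMul_le fun a ha b hb ↦ by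
        simpa [mul_assoc] using mul_mem_subgroupMul ha (mul_mem_subgroupMul hb hc)
    exact h hx
  · refine subgroupMul_le fun a ha x hx ↦ ?_
    have h : subgroupMul B C ≤
        (subgroupMul (subgroupMul A B) C).comap (AddMonoidHom.mulLeft a) :=
      subgroupMul_le fun b hb c hc ↦ by
        simpa [mul_assoc] using mul_mem_subgroupMul (mul_mem_subgroupMul ha hb) hc
    exact h hx

theorem mul_eq_self_of_mem_subgroupMul {A B : AddSubgroup R} {u : R}
    (hu : ∀ a ∈ A, u * a = a) {x : R} (hx : x ∈ subgroupMul A B) : u * x = x := by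
  have h : subgroupMul A B ≤ (AddMonoidHom.mulLeft u).eqLocus (AddMonoidHom.id R) :=
    subgroupMul_le fun a ha b _ ↦ by
      change u * (a * b) = a * b
      rw [← mul_assoc, hu a ha]
  exact h hx

theorem self_mul_eq_of_mem_subgroupMul {A B : AddSubgroup R} {u : R}
    (hu : ∀ b ∈ B, b * u = b) {x : R} (hx : x ∈ subgroupMul A B) : x * u = x := by
  have h : subgroupMul A B ≤ (AddMonoidHom.mulRight u).eqLocus (AddMonoidHom.id R) :=
    subgroupMul_le fun a _ b hb ↦ by
      change a * b * u = a * b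
      rw [mul_assoc, hu b hb]
  exact h hx

/-- A left identity and a right identity of `P`, both in `P`, make `P` unital. -/
theorem HasUnity.of_left_right {P : AddSubgroup R} {u v : R} (hu : u ∈ P) (hv : v ∈ P)
    (hul : ∀ x ∈ P, u * x = x) (hvr : ∀ x ∈ P, x * v = x) : HasUnity P := by
  have huv : u = v := (hvr u hu).symm.trans (hul v hv)
  exact ⟨u, hu, fun x hx ↦ ⟨hul x hx, huv ▸ hvr x hx⟩⟩

end SubgroupMul

theorem mem_invSet_symm {S : Type*} [Semigroup S] {s t : S} (h : t ∈ invSet s) :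
    s ∈ invSet t :=
  ⟨h.2, h.1⟩

theorem IsSemigroupGrading.subgroupMul_le {S R : Type*} [Semigroup S] [DecidableEq S]
    [NonUnitalRing R] {𝒜 : S → AddSubgroup R} (hgr : IsSemigroupGrading 𝒜) (s t : S) :
    subgroupMul (𝒜 s) (𝒜 t) ≤ 𝒜 (s * t) :=
  _root_.subgroupMul_le (hgr.mul_mem s t)

/-- **Proposition (epsilon-strong gradings).**
An `S`-graded ring `R` is epsilon-strongly `S`-graded if and only if for all `s ∈ S` and
`t ∈ V(s)` there exist `ε_{s,t} ∈ R_s R_t` and `ε'_{t,s} ∈ R_t R_s` such that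
`ε_{s,t} r = r = r ε'_{t,s}` for every `r ∈ R_s`. -/
theorem epsilonStronglyGraded_iff {S R : Type*} [Semigroup S] [DecidableEq S] [NonUnitalRing R]
    (𝒜 : S → AddSubgroup R) (hgr : IsSemigroupGrading 𝒜) :
    EpsilonStronglyGraded 𝒜 ↔
      ∀ s : S, ∀ t ∈ invSet s,
        ∃ ε ∈ subgroupMul (𝒜 s) (𝒜 t), ∃ ε' ∈ subgroupMul (𝒜 t) (𝒜 s),
          ∀ r ∈ 𝒜 s, ε * r = r ∧ r * ε' = r := by
  constructor
  · rintro ⟨hsymm, hunit⟩ s t ht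
    obtain ⟨u, hu, hu'⟩ := hunit s t ht
    obtain ⟨v, hv, hv'⟩ := hunit t s (mem_invSet_symm ht)
    refine ⟨u, hu, v, hv, fun r hr ↦ ?_⟩
    rw [hsymm s t ht] at hr
    refine ⟨mul_eq_self_of_mem_subgroupMul (fun x hx ↦ (hu' x hx).1) hr, ?_⟩
    rw [subgroupMul_assoc] at hr
    exact self_mul_eq_of_mem_subgroupMul (fun x hx ↦ (hv' x hx).2) hr
  · intro h
    refine ⟨fun s t ht ↦ le_antisymm (fun r hr ↦ ?_) ?_, fun s t ht ↦ ?_⟩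
    · obtain ⟨ε, hε, _, _, hr'⟩ := h s t ht
      rw [← (hr' r hr).1]
      exact mul_mem_subgroupMul hε hr
    · refine subgroupMul_le fun x hx a ha ↦ ?_
      have := hgr.mul_mem (s * t) s x (hgr.subgroupMul_le s t hx) a ha
      rwa [ht.1] at this
    · obtain ⟨ε, hε, _, _, hl⟩ := h s t ht
      obtain ⟨_, _, ε', hε', hr⟩ := h t s (mem_invSet_symm ht)
      exact .of_left_right hε hε'
        (fun _ ↦ mul_eq_self_of_mem_subgroupMul fun a ha ↦ (hl a ha).1)
        (fun _ ↦ self_mul_eq_of_mem_subgroupMul fun b hb ↦ (hr b hb).2)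
end

section
/- Let S be a semigroup and let R be a strongly S-graded ring. Then R is nearly epsilon-strongly S-graded if and only if R_e is an s-unital ring for every e ∈ E(S). -/
open scoped Pointwise

/-- **Remark.** Let `R` be a strongly `S`-graded ring. Then `R` is nearly
epsilon-strongly `S`-graded if and only if `R_e` is s-unital for every `e ∈ E(S)`. -/
theorem nearlyEpsilonStronglyGraded_iff_of_stronglyGraded
    {S R : Type*} [Semigroup S] [DecidableEq S] [NonUnitalRing R]
    (𝒜 : S → AddSubgroup R) (hgr : IsSemigroupGrading 𝒜)
    (hstr : StronglyGraded 𝒜) :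
    NearlyEpsilonStronglyGraded 𝒜 ↔ ∀ e ∈ idempotentSet S, IsSUnital (𝒜 e) := by
  constructor
  · rintro ⟨-, h⟩ e he
    have he' : e * e = e := he
    have hV : e ∈ invSet e := by simp [invSet, he']
    simpa only [hstr e e, he'] using h e e hV
  · intro h
    refine ⟨fun s t ht => ?_, fun s t ht => ?_⟩
    · rw [hstr, hstr, ht.1]
    · rw [hstr]
      refine h (s * t) ?_
      change s * t * (s * t) = s * t
      rw [← mul_assoc, ht.1]
end

section
/- Let S be a semigroup and let R be a strongly S-graded ring such that R_e is an s-unital ring for every e ∈ E(S). Then R is graded von Neumann regular if and only if R_e is a von Neumann regular ring for every e ∈ E(S). -/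
open scoped Pointwise

/-- If `A` is closed under multiplication and each of its elements has a left unit in `A`,
then so does each element of `A B`. -/
theorem exists_left_unit_of_mem_subgroupMul {R : Type*} [NonUnitalRing R] {A B : AddSubgroup R}
    (hmul : ∀ a ∈ A, ∀ b ∈ A, a * b ∈ A) (hunit : ∀ a ∈ A, ∃ u ∈ A, u * a = a)
    {x : R} (hx : x ∈ subgroupMul A B) : ∃ u ∈ A, u * x = x := by
  -- Any `u` can be enlarged to a left unit of `x` without losing the elements it already fixes.
  suffices H : ∀ u ∈ A, ∃ w ∈ A, w * x = x ∧ ∀ y, u * y = y → w * y = y by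
    obtain ⟨w, hw, hwx, -⟩ := H 0 A.zero_mem
    exact ⟨w, hw, hwx⟩
  induction hx using AddSubgroup.closure_induction with
  | mem x hx =>
    obtain ⟨a, ha, b, -, rfl⟩ := Set.mem_mul.1 hx
    intro u hu
    obtain ⟨v, hv, hva⟩ := hunit (a - u * a) (A.sub_mem ha (hmul u hu a ha))
    have hfix : ∀ y, (u + v - v * u) * y = u * y + v * (y - u * y) := fun y => by
      simp only [sub_mul, add_mul, mul_sub, mul_assoc]
      abel
    refine ⟨u + v - v * u, A.sub_mem (A.add_mem hu hv) (hmul v hv u hu), ?_, fun y hy => ?_⟩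
    · rw [← mul_assoc, hfix, hva, add_sub_cancel]
    · rw [hfix, hy, sub_self, mul_zero, add_zero]
  | zero => exact fun u hu => ⟨u, hu, mul_zero u, fun _ => id⟩
  | add x y _ _ ihx ihy =>
    intro u hu
    obtain ⟨v, hv, hvx, huv⟩ := ihx u hu
    obtain ⟨w, hw, hwy, hvw⟩ := ihy v hv
    exact ⟨w, hw, by rw [mul_add, hvw x hvx, hwy], fun z hz => hvw z (huv z hz)⟩
  | neg x _ ih =>
    intro u hu
    obtain ⟨w, hw, hwx, huw⟩ := ih u hu
    exact ⟨w, hw, by rw [mul_neg, hwx], huw⟩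

/-- If `B` is closed under multiplication and each of its elements has a right unit in `B`,
then so does each element of `A B`. -/
theorem exists_right_unit_of_mem_subgroupMul {R : Type*} [NonUnitalRing R] {A B : AddSubgroup R}
    (hmul : ∀ a ∈ B, ∀ b ∈ B, a * b ∈ B) (hunit : ∀ b ∈ B, ∃ u ∈ B, b * u = b)
    {x : R} (hx : x ∈ subgroupMul A B) : ∃ u ∈ B, x * u = x := by
  suffices H : ∀ u ∈ B, ∃ w ∈ B, x * w = x ∧ ∀ y, y * u = y → y * w = y by
    obtain ⟨w, hw, hwx, -⟩ := H 0 B.zero_mem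
    exact ⟨w, hw, hwx⟩
  induction hx using AddSubgroup.closure_induction with
  | mem x hx =>
    obtain ⟨a, -, b, hb, rfl⟩ := Set.mem_mul.1 hx
    intro u hu
    obtain ⟨v, hv, hvb⟩ := hunit (b - b * u) (B.sub_mem hb (hmul b hb u hu))
    have hfix : ∀ y, y * (u + v - u * v) = y * u + (y - y * u) * v := fun y => by
      simp only [sub_mul, mul_add, mul_sub, mul_assoc]
      abel
    refine ⟨u + v - u * v, B.sub_mem (B.add_mem hu hv) (hmul u hu v hv), ?_, fun y hy => ?_⟩
    · rw [mul_assoc, hfix, hvb, add_sub_cancel]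
    · rw [hfix, hy, sub_self, zero_mul, add_zero]
  | zero => exact fun u hu => ⟨u, hu, zero_mul u, fun _ => id⟩
  | add x y _ _ ihx ihy =>
    intro u hu
    obtain ⟨v, hv, hvx, huv⟩ := ihx u hu
    obtain ⟨w, hw, hwy, hvw⟩ := ihy v hv
    exact ⟨w, hw, by rw [add_mul, hvw x hvx, hwy], fun z hz => hvw z (huv z hz)⟩
  | neg x _ ih =>
    intro u hu
    obtain ⟨w, hw, hwx, huw⟩ := ih u hu
    exact ⟨w, hw, by rw [neg_mul, hwx], huw⟩

/-- Left multiplication by `r` maps `A B` into `(r A) B`. -/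
theorem mul_mem_subgroupMul_map_mulLeft {R : Type*} [NonUnitalRing R] {A B : AddSubgroup R}
    (r : R) {x : R} (hx : x ∈ subgroupMul A B) :
    r * x ∈ subgroupMul (A.map (AddMonoidHom.mulLeft r)) B := by
  induction hx using AddSubgroup.closure_induction with
  | mem x hx =>
    obtain ⟨a, ha, b, hb, rfl⟩ := Set.mem_mul.1 hx
    rw [← mul_assoc]
    exact AddSubgroup.subset_closure (Set.mul_mem_mul ⟨a, ha, rfl⟩ hb)
  | zero => rw [mul_zero]; exact AddSubgroup.zero_mem _
  | add x y _ _ ihx ihy => rw [mul_add]; exact AddSubgroup.add_mem _ ihx ihy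
  | neg x _ ih => rw [mul_neg]; exact AddSubgroup.neg_mem _ ih

/-- **Corollary.** Let `S` be a semigroup and `R` a strongly `S`-graded ring for which
`R_e` is s-unital for every `e ∈ E(S)`. Then `R` is graded von Neumann regular if and
only if `R_e` is von Neumann regular for every `e ∈ E(S)`. -/
theorem gradedVonNeumannRegular_iff_of_stronglyGraded
    {S R : Type*} [Semigroup S] [DecidableEq S] [NonUnitalRing R]
    (𝒜 : S → AddSubgroup R) (hgr : IsSemigroupGrading 𝒜)
    (hstr : StronglyGraded 𝒜) (hsu : ∀ e ∈ idempotentSet S, IsSUnital (𝒜 e)) :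
    GradedVonNeumannRegular 𝒜 ↔ ∀ e ∈ idempotentSet S, IsVonNeumannRegular (𝒜 e) := by
  refine ⟨fun h e he r hr => ?_, fun h s r hr t ht => ?_⟩
  · have he' : e * e = e := he
    exact h e r hr e ⟨by rw [he', he'], by rw [he', he']⟩
  obtain ⟨hsts, htst⟩ := ht
  have hst : s * t ∈ idempotentSet S := show s * t * (s * t) = s * t by rw [← mul_assoc, hsts]
  have hts : t * s ∈ idempotentSet S := show t * s * (t * s) = t * s by rw [← mul_assoc, htst]
  obtain ⟨v, hv, hrv⟩ : ∃ v ∈ 𝒜 (t * s), r * v = r := by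
    refine exists_right_unit_of_mem_subgroupMul (A := 𝒜 s) (fun a ha b hb => ?_)
      (fun b hb => (hsu _ hts b hb).2) ?_
    · have hab := hgr.mul_mem _ _ a ha b hb
      rwa [show t * s * (t * s) = t * s from hts] at hab
    · rwa [hstr, ← mul_assoc, hsts]
  have hrv_mem := mul_mem_subgroupMul_map_mulLeft r ((hstr t s).symm ▸ hv)
  rw [hrv] at hrv_mem
  -- `r R_t` is a right ideal of the regular ring `R_{st}`, hence left s-unital.
  have hright : ∀ c ∈ 𝒜 t, ∀ z ∈ 𝒜 (s * t),
      r * c * z ∈ (𝒜 t).map (AddMonoidHom.mulLeft r) := fun c hc z hz => by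
    have hcz := hgr.mul_mem _ _ c hc z hz
    rw [← mul_assoc, htst] at hcz
    exact ⟨c * z, hcz, (mul_assoc r c z).symm⟩
  obtain ⟨_, ⟨y, hy, rfl⟩, hyr⟩ := exists_left_unit_of_mem_subgroupMul
    (by
      rintro _ ⟨c, hc, rfl⟩ _ ⟨d, hd, rfl⟩
      exact hright c hc _ (hgr.mul_mem _ _ r hr d hd))
    (by
      rintro _ ⟨c, hc, rfl⟩
      obtain ⟨z, hz, hrz⟩ := h _ hst (r * c) (hgr.mul_mem _ _ r hr c hc)
      exact ⟨r * c * z, hright c hc z hz, hrz.symm⟩) hrv_mem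
  exact ⟨y, hy, hyr.symm⟩
end
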